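/- arXiv:1607.00700 — 3 statements merged into one kernel-verified Lean document; each statement's English description precedes it below -/
import Mathlib

section
/- Let p be an odd prime and let m ≥ 1 be an odd integer. If p−1 does not divide m+1, then ∑_{k=1}^{p−1} 1/k^m ≡ 0 (mod p²); if p−1 divides m+1, then ∑_{k=1}^{p−1} 1/k^m ≡ (1/2)·m·p (mod p²). -/
open Finset

/-- A rational number is a `p`-integer if its `p`-adic valuation is nonnegative
(equivalently, its denominator is not divisible by `p`). -/
def IsPInteger (p : ℕ) (x : ℚ) : Prop := 0 ≤ padicValRat p x

/-- `a ≡ b (mod p^m)` for `p`-integers: `(a - b) / p^m` is a `p`-integer. -/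
def PModEq (p m : ℕ) (a b : ℚ) : Prop := IsPInteger p ((a - b) / (p : ℚ) ^ m)

theorem isPInteger_iff_norm_le_one (p : ℕ) [Fact p.Prime] (x : ℚ) :
    IsPInteger p x ↔ ‖(x : ℚ_[p])‖ ≤ 1 := by
  rw [IsPInteger, ← Padic.valuation_ratCast, Padic.norm_le_one_iff_val_nonneg]

theorem sq_dvd_pow_add_pow_add_of_mul_eq_one {R : Type*} [CommRing R] {a q u v : R}
    (hu : a * u = 1) (hv : (q - a) * v = 1) {m : ℕ} (hm : Odd m) :
    q ^ 2 ∣ u ^ m + v ^ m + m * q * u ^ (m + 1) := by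
  have h₁ : q ^ 2 ∣ v - -(u + q * u ^ 2) :=
    ⟨u ^ 2 * v, by linear_combination (-u - q * u ^ 2) * hv - (v + q * u * v) * hu⟩
  have h₂ := h₁.trans (sub_dvd_pow_sub_pow v (-(u + q * u ^ 2)) m)
  rw [hm.neg_pow] at h₂
  obtain ⟨c, hc⟩ := Polynomial.powAddExpansion u (q * u ^ 2) m
  obtain ⟨d, hd⟩ := h₂
  obtain ⟨n, rfl⟩ := hm
  refine ⟨d - c * u ^ 4, ?_⟩
  simp only [Nat.add_sub_cancel] at hc
  linear_combination hd - hc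

theorem sum_Icc_natCast_eq_sum_units {p : ℕ} [Fact p.Prime] {M : Type*} [AddCommMonoid M]
    (f : ZMod p → M) : ∑ k ∈ Icc 1 (p - 1), f k = ∑ x : (ZMod p)ˣ, f x := by
  have hp := (Fact.out : p.Prime).pos
  symm
  refine sum_bij (fun x _ ↦ (x : ZMod p).val) (fun x _ ↦ ?_) (fun x _ y _ h ↦ ?_)
    (fun k hk ↦ ?_) (fun x _ ↦ ?_)
  · have h₁ := ZMod.val_lt (x : ZMod p)
    have h₂ : (x : ZMod p).val ≠ 0 := by simp [ZMod.val_eq_zero]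
    rw [mem_Icc]
    omega
  · exact Units.ext (ZMod.val_injective p h)
  · rw [mem_Icc] at hk
    have hk₀ : (k : ZMod p) ≠ 0 := by
      rw [Ne, ZMod.natCast_eq_zero_iff]
      exact Nat.not_dvd_of_pos_of_lt (by omega) (by omega)
    exact ⟨Units.mk0 _ hk₀, mem_univ _, by
      rw [Units.val_mk0, ZMod.val_natCast_of_lt (by omega)]⟩
  · rw [ZMod.natCast_zmod_val]

theorem sum_Icc_inv_pow_zmod (p : ℕ) [Fact p.Prime] (i : ℕ) :
    ∑ k ∈ Icc 1 (p - 1), ((k : ZMod p)⁻¹) ^ i = if (p - 1) ∣ i then -1 else 0 := by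
  rw [sum_Icc_natCast_eq_sum_units (fun x : ZMod p ↦ x⁻¹ ^ i)]
  have h := FiniteField.sum_pow_units (ZMod p) i
  rw [ZMod.card] at h
  rw [← h]
  exact Fintype.sum_equiv (Equiv.inv _) _ _ fun x ↦ by
    rw [Equiv.inv_apply, Units.val_inv_eq_inv_val]

theorem PadicInt.mul_inv_natCast {p : ℕ} [Fact p.Prime] {k : ℕ} (hk : k ∈ Icc 1 (p - 1)) :
    (k : ℤ_[p]) * (k : ℤ_[p]).inv = 1 := by
  rw [mem_Icc] at hk
  refine PadicInt.mul_inv ?_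
  rw [PadicInt.norm_natCast_eq_one_iff]
  exact Nat.coprime_of_lt_prime (by omega) (by omega) Fact.out

theorem PadicInt.dvd_sum_inv_pow_sub (p : ℕ) [Fact p.Prime] (i : ℕ) :
    (p : ℤ_[p]) ∣ ∑ k ∈ Icc 1 (p - 1), (k : ℤ_[p]).inv ^ i -
      (if (p - 1) ∣ i then -1 else 0) := by
  rw [← Ideal.mem_span_singleton, ← PadicInt.maximalIdeal_eq_span_p, ← PadicInt.ker_toZMod,
    RingHom.mem_ker, map_sub, map_sum, sub_eq_zero]
  trans ∑ k ∈ Icc 1 (p - 1), ((k : ZMod p)⁻¹) ^ i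
  · refine sum_congr rfl fun k hk ↦ ?_
    rw [map_pow]
    congr 1
    refine eq_inv_of_mul_eq_one_right ?_
    rw [← map_natCast (PadicInt.toZMod (p := p)), ← map_mul, PadicInt.mul_inv_natCast hk, map_one]
  · rw [sum_Icc_inv_pow_zmod]
    split_ifs <;> simp

theorem PadicInt.sq_dvd_two_mul_sum_inv_pow_sub (p : ℕ) [Fact p.Prime] {m : ℕ} (hm : Odd m) :
    (p : ℤ_[p]) ^ 2 ∣ 2 * ∑ k ∈ Icc 1 (p - 1), (k : ℤ_[p]).inv ^ m -
      (if (p - 1) ∣ (m + 1) then 1 else 0) * m * p := by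
  have hreflect : ∑ k ∈ Icc 1 (p - 1), (k : ℤ_[p]).inv ^ m =
      ∑ k ∈ Icc 1 (p - 1), ((p - k : ℕ) : ℤ_[p]).inv ^ m := by
    refine sum_nbij' (fun k ↦ p - k) (fun k ↦ p - k) ?_ ?_ ?_ ?_ ?_ <;> intro k hk <;>
      rw [mem_Icc] at hk
    · rw [mem_Icc]; omega
    · rw [mem_Icc]; omega
    · omega
    · omega
    · rw [Nat.sub_sub_self (by omega)]
  have hpairs : (p : ℤ_[p]) ^ 2 ∣ ∑ k ∈ Icc 1 (p - 1), ((k : ℤ_[p]).inv ^ m +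
      ((p - k : ℕ) : ℤ_[p]).inv ^ m + m * p * (k : ℤ_[p]).inv ^ (m + 1)) := by
    refine dvd_sum fun k hk ↦ ?_
    refine sq_dvd_pow_add_pow_add_of_mul_eq_one (PadicInt.mul_inv_natCast hk) ?_ hm
    rw [mem_Icc] at hk
    rw [← Nat.cast_sub (by omega)]
    exact PadicInt.mul_inv_natCast (by rw [mem_Icc]; omega)
  rw [sum_add_distrib, sum_add_distrib, ← hreflect, ← mul_sum] at hpairs
  obtain ⟨c, hc⟩ := hpairs
  obtain ⟨d, hd⟩ := PadicInt.dvd_sum_inv_pow_sub p (m + 1)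
  refine ⟨c - m * d, ?_⟩
  split_ifs at hd ⊢ <;> linear_combination hc - m * p * hd

theorem pModEq_sum_inv_pow (p : ℕ) (hp : p.Prime) (hodd : Odd p) {m : ℕ} (hm : Odd m) :
    PModEq p 2 (∑ k ∈ Icc 1 (p - 1), (1 : ℚ) / (k ^ m))
      (if (p - 1) ∣ (m + 1) then (1 / 2) * m * p else 0) := by
  have : Fact p.Prime := ⟨hp⟩
  have hp₀ : (p : ℚ_[p]) ≠ 0 := mod_cast hp.ne_zero
  have hsum : PadicInt.Coe.ringHom (∑ k ∈ Icc 1 (p - 1), (k : ℤ_[p]).inv ^ m) =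
      ∑ k ∈ Icc 1 (p - 1), 1 / (k : ℚ_[p]) ^ m := by
    rw [map_sum]
    refine sum_congr rfl fun k hk ↦ ?_
    rw [map_pow, one_div, ← inv_pow]
    congr 1
    refine eq_inv_of_mul_eq_one_right ?_
    rw [← map_natCast (PadicInt.Coe.ringHom (p := p)), ← map_mul,
      PadicInt.mul_inv_natCast hk, map_one]
  obtain ⟨t, ht⟩ := PadicInt.sq_dvd_two_mul_sum_inv_pow_sub p hm
  replace ht := congrArg PadicInt.Coe.ringHom ht
  simp only [map_sub, map_mul, map_pow, map_natCast, map_ofNat, hsum] at ht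
  have hnorm : ‖(2 : ℚ_[p])‖ = 1 := by
    exact_mod_cast (Padic.norm_natCast_eq_one_iff (p := p) (n := 2)).2 hodd.coprime_two_right
  rw [PModEq, isPInteger_iff_norm_le_one, ← one_mul ‖_‖, ← hnorm, ← norm_mul]
  convert t.norm_le_one using 1
  rw [PadicInt.norm_def]
  congr 1
  change _ = PadicInt.Coe.ringHom t
  push_cast
  rw [← mul_div_assoc, div_eq_iff (pow_ne_zero 2 hp₀), mul_comm (PadicInt.Coe.ringHom t), ← ht]
  split_ifs <;> simp only [map_one, map_zero] <;> push_cast <;> ring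

theorem power_sum_mod_p_sq (p : ℕ) (hp : p.Prime) (hodd : Odd p)
    (m : ℕ) (hm : 1 ≤ m) (hmodd : Odd m) :
    (¬ (p - 1) ∣ (m + 1) →
      PModEq p 2 (∑ k ∈ Finset.Icc 1 (p - 1), (1 : ℚ) / (k ^ m)) 0) ∧
    ((p - 1) ∣ (m + 1) →
      PModEq p 2 (∑ k ∈ Finset.Icc 1 (p - 1), (1 : ℚ) / (k ^ m)) ((1 / 2) * m * p)) := by
  have h := pModEq_sum_inv_pow p hp hodd hmodd
  exact ⟨fun hdvd ↦ by rwa [if_neg hdvd] at h, fun hdvd ↦ by rwa [if_pos hdvd] at h⟩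
end

section
/- Let p be an odd prime and let m ≥ 1 be an odd integer such that p−1 does not divide m+5. Then (∑_{k=1}^{p−1} 1/k^m) + (1/2)·m·p·(∑_{k=1}^{p−1} 1/k^{m+1}) + (m(m+1)/12)·p²·(∑_{k=1}^{p−1} 1/k^{m+2}) ≡ 0 (mod p⁶). -/
open Finset

/-- The expansion of `24 (1 - t) ^ n` modulo `t ^ 6`, with a fifth coefficient independent of
`t`. -/
lemma exists_one_sub_pow_expansion (R : Type*) [CommRing R] (n : ℕ) :
    ∃ e : R, ∀ t : R, ∃ q : R, 24 * (1 - t) ^ n =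
      24 - 24 * n * t + 12 * n * (n - 1) * t ^ 2 - 4 * n * (n - 1) * (n - 2) * t ^ 3
        + n * (n - 1) * (n - 2) * (n - 3) * t ^ 4 + e * t ^ 5 + q * t ^ 6 := by
  induction n with
  | zero => exact ⟨0, fun t => ⟨0, by simp⟩⟩
  | succ n ih =>
    obtain ⟨e, he⟩ := ih
    refine ⟨e - n * (n - 1) * (n - 2) * (n - 3), fun t => ?_⟩
    obtain ⟨q, hq⟩ := he t
    refine ⟨q * (1 - t) - e, ?_⟩
    push_cast
    linear_combination (1 - t) * hq

/-- Pairing the summands at `k` and `p - k` (with inverses `u` and `v`) of the power sum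
combination leaves only a multiple of `p ^ 5 * u ^ (m + 5)` modulo `p ^ 6`. -/
lemma exists_add_reflection_expansion (R : Type*) [CommRing R] (m : ℕ) (hm : Odd m) :
    ∃ C : R, ∀ p k u v : R, k * u = 1 → (p - k) * v = 1 → ∃ q : R,
      24 * ((12 * u ^ m + 6 * m * p * u ^ (m + 1) + m * (m + 1) * p ^ 2 * u ^ (m + 2))
        + (12 * v ^ m + 6 * m * p * v ^ (m + 1) + m * (m + 1) * p ^ 2 * v ^ (m + 2)))
      = C * p ^ 5 * u ^ (m + 5) + q * p ^ 6 := by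
  obtain ⟨e, he⟩ := exists_one_sub_pow_expansion R (m + 2)
  refine ⟨12 * e + 6 * m * ((m + 2) * (m + 1) * m * (m - 1))
    - 4 * (m * (m + 1)) * ((m + 2) * (m + 1) * m), fun p k u v hu hv => ?_⟩
  set C : R := 12 * e + 6 * m * ((m + 2) * (m + 1) * m * (m - 1))
    - 4 * (m * (m + 1)) * ((m + 2) * (m + 1) * m) with hC
  obtain ⟨t, ht⟩ : ∃ t, t = p * u := ⟨_, rfl⟩
  obtain ⟨w, hw⟩ : ∃ w, w = -(k * v) := ⟨_, rfl⟩
  have hwt : w * (1 - t) = 1 := by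
    rw [hw, ht]; linear_combination hv + p * v * hu
  have hvw : v = -(u * w) := by rw [hw]; linear_combination -v * hu
  obtain ⟨q, hq⟩ := he t
  obtain ⟨r, hr⟩ : w - 1 ∣ w ^ (m + 2) - 1 := sub_one_dvd_pow_sub_one w (m + 2)
  have hr' : w ^ (m + 2) = 1 + t * (w * r) := by linear_combination hr + r * hwt
  have hP : 24 * ((1 - t) ^ (m + 2) * (12 + 6 * m * t + m * (m + 1) * t ^ 2)
      - (12 * (1 - t) ^ 2 - 6 * m * t * (1 - t) + m * (m + 1) * t ^ 2))
      = C * t ^ 5 + t ^ 6 * (q * (12 + 6 * m * t + m * (m + 1) * t ^ 2)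
        + 6 * m * e + m * (m + 1) * ((m + 2) * (m + 1) * m * (m - 1)) + m * (m + 1) * e * t) := by
    push_cast at hq
    rw [hC]
    linear_combination (12 + 6 * m * t + m * (m + 1) * t ^ 2) * hq
  obtain ⟨Q, hQ⟩ : ∃ Q, Q = q * (12 + 6 * m * t + m * (m + 1) * t ^ 2)
        + 6 * m * e + m * (m + 1) * ((m + 2) * (m + 1) * m * (m - 1)) + m * (m + 1) * e * t :=
    ⟨_, rfl⟩
  rw [← hQ] at hP
  have hwm : w ^ (m + 2) * (1 - t) ^ (m + 2) = 1 := by rw [← mul_pow, hwt, one_pow]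
  have hGu : 12 * u ^ m + 6 * m * p * u ^ (m + 1) + m * (m + 1) * p ^ 2 * u ^ (m + 2)
      = u ^ m * w ^ (m + 2) * ((1 - t) ^ (m + 2) * (12 + 6 * m * t + m * (m + 1) * t ^ 2)) := by
    have : u ^ m * w ^ (m + 2) * ((1 - t) ^ (m + 2) * (12 + 6 * m * t + m * (m + 1) * t ^ 2))
      = u ^ m * (12 + 6 * m * t + m * (m + 1) * t ^ 2) := by
      linear_combination u ^ m * (12 + 6 * m * t + m * (m + 1) * t ^ 2) * hwm
    rw [this, ht]; ring
  have hGv : 12 * v ^ m + 6 * m * p * v ^ (m + 1) + m * (m + 1) * p ^ 2 * v ^ (m + 2)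
      = -(u ^ m * w ^ (m + 2)
        * (12 * (1 - t) ^ 2 - 6 * m * t * (1 - t) + m * (m + 1) * t ^ 2)) := by
    have hvm : v ^ m = -(u ^ m * w ^ m) := by rw [hvw, hm.neg_pow, mul_pow]
    have hpv : p * v = -(t * w) := by rw [hvw, ht]; ring
    have : 12 * v ^ m + 6 * m * p * v ^ (m + 1) + m * (m + 1) * p ^ 2 * v ^ (m + 2)
      = v ^ m * (12 + 6 * m * (p * v) + m * (m + 1) * (p * v) ^ 2) := by ring
    rw [this, hvm, hpv]
    linear_combination (u ^ m * w ^ m * (12 * (w * (1 - t) + 1) - 6 * m * t * w)) * hwt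
  refine ⟨u ^ (m + 6) * (w ^ (m + 2) * Q + C * (w * r)), ?_⟩
  have h1 : C * p ^ 5 * u ^ (m + 5) + u ^ (m + 6) * (w ^ (m + 2) * Q + C * (w * r)) * p ^ 6
      = u ^ m * (C * t ^ 5 * (1 + t * (w * r)) + w ^ (m + 2) * t ^ 6 * Q) := by
    rw [ht]; ring
  rw [h1, ← hr', hGu, hGv]
  linear_combination u ^ m * w ^ (m + 2) * hP

lemma ZMod.sum_inv_pow_eq_zero (p : ℕ) [Fact p.Prime] (n : ℕ) (hn : ¬ (p - 1) ∣ n) :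
    ∑ k ∈ Icc 1 (p - 1), ((k : ZMod p)⁻¹) ^ n = 0 := by
  have hp : p.Prime := Fact.out
  have h := FiniteField.sum_pow_units (ZMod p) n
  rw [ZMod.card, if_neg hn, ← Equiv.sum_comp (Equiv.inv (ZMod p)ˣ)] at h
  rw [← h]
  symm
  refine Finset.sum_bij (fun x _ => (x : ZMod p).val) ?_ ?_ ?_ ?_
  · intro x _
    have h1 := ZMod.val_lt (x : ZMod p)
    have h2 : (x : ZMod p).val ≠ 0 := by
      rw [Ne, ZMod.val_eq_zero]; exact x.ne_zero
    rw [mem_Icc]; omega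
  · intro x _ y _ hxy
    exact Units.ext (ZMod.val_injective p hxy)
  · intro k hk
    rw [mem_Icc] at hk
    have hkp : k < p := by have := hp.pos; omega
    have hk0 : (k : ZMod p) ≠ 0 := by
      rw [Ne, ZMod.natCast_eq_zero_iff]
      exact Nat.not_dvd_of_pos_of_lt hk.1 hkp
    exact ⟨Units.mk0 _ hk0, mem_univ _, by simp [ZMod.val_cast_of_lt hkp]⟩
  · intro x _
    rw [ZMod.natCast_zmod_val, Equiv.inv_apply, Units.val_inv_eq_inv_val]

lemma PadicInt.isUnit_natCast_of_not_dvd {p : ℕ} [Fact p.Prime] {k : ℕ} (hk : ¬ p ∣ k) :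
    IsUnit (k : ℤ_[p]) := by
  rw [PadicInt.isUnit_iff]
  by_contra h
  exact hk (PadicInt.norm_natCast_lt_one_iff.1 (lt_of_le_of_ne (PadicInt.norm_le_one _) h))

lemma isPInteger_of_padicInt_eq {p : ℕ} [Fact p.Prime] {x : ℚ} (y : ℤ_[p])
    (h : (x : ℚ_[p]) = y) : IsPInteger p x := by
  unfold IsPInteger
  rcases eq_or_ne x 0 with rfl | hx
  · simp
  have h1 : padicNorm p x ≤ 1 := by
    have := PadicInt.norm_le_one y
    rw [PadicInt.norm_def, ← h, Padic.eq_padicNorm] at this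
    exact_mod_cast this
  rw [padicNorm.eq_zpow_of_nonzero hx] at h1
  have hp : (1 : ℚ) < p := by exact_mod_cast (Fact.out : p.Prime).one_lt
  have := (zpow_le_one_iff_right₀ hp).1 h1
  omega

theorem power_sum_combination_mod_p6 (p : ℕ) (hp : p.Prime) (hodd : Odd p)
    (m : ℕ) (hm : 1 ≤ m) (hmodd : Odd m) (hdvd : ¬ (p - 1) ∣ (m + 5)) :
    PModEq p 6
      ((∑ k ∈ Finset.Icc 1 (p - 1), (1 : ℚ) / (k ^ m))
        + (1 / 2) * m * p * (∑ k ∈ Finset.Icc 1 (p - 1), (1 : ℚ) / (k ^ (m + 1)))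
        + (m * (m + 1) / 12) * p ^ 2 *
            (∑ k ∈ Finset.Icc 1 (p - 1), (1 : ℚ) / (k ^ (m + 2)))) 0 := by
  have : Fact p.Prime := ⟨hp⟩
  have hp2 : p ≠ 2 := by rintro rfl; exact absurd hodd (by decide)
  have hp3 : p ≠ 3 := by
    rintro rfl
    obtain ⟨a, rfl⟩ := hmodd
    exact hdvd ⟨a + 3, by omega⟩
  have h576 : IsUnit (576 : ℤ_[p]) := by
    have : ¬ p ∣ 2 ^ 6 * 3 ^ 2 := by
      rw [hp.dvd_mul]
      rintro (h | h)
      · exact hp2 ((Nat.prime_dvd_prime_iff_eq hp Nat.prime_two).1 (hp.dvd_of_dvd_pow h))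
      · exact hp3 ((Nat.prime_dvd_prime_iff_eq hp Nat.prime_three).1 (hp.dvd_of_dvd_pow h))
    simpa using PadicInt.isUnit_natCast_of_not_dvd this
  have hinv : ∀ k : ℕ, ∃ u : ℤ_[p], k ∈ Icc 1 (p - 1) → (k : ℤ_[p]) * u = 1 := by
    intro k
    by_cases hk : k ∈ Icc 1 (p - 1)
    · obtain ⟨u, hu⟩ := (PadicInt.isUnit_natCast_of_not_dvd (p := p) (k := k) (by
        rw [mem_Icc] at hk
        exact Nat.not_dvd_of_pos_of_lt hk.1 (by omega))).exists_right_inv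
      exact ⟨u, fun _ => hu⟩
    · exact ⟨0, fun h => absurd h hk⟩
  choose U hU using hinv
  have hrefl : ∀ k ∈ Icc 1 (p - 1), p - k ∈ Icc 1 (p - 1) := by
    intro k hk
    rw [mem_Icc] at hk ⊢
    omega
  obtain ⟨C, hC⟩ := exists_add_reflection_expansion ℤ_[p] m hmodd
  have hpair : ∀ k : ℕ, ∃ q : ℤ_[p], k ∈ Icc 1 (p - 1) →
      24 * ((12 * U k ^ m + 6 * m * p * U k ^ (m + 1) + m * (m + 1) * p ^ 2 * U k ^ (m + 2))
        + (12 * U (p - k) ^ m + 6 * m * p * U (p - k) ^ (m + 1)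
          + m * (m + 1) * p ^ 2 * U (p - k) ^ (m + 2)))
      = C * p ^ 5 * U k ^ (m + 5) + q * p ^ 6 := by
    intro k
    by_cases hk : k ∈ Icc 1 (p - 1)
    · have h := hU _ (hrefl k hk)
      rw [Nat.cast_sub (by rw [mem_Icc] at hk; omega)] at h
      obtain ⟨q, hq⟩ := hC p k (U k) (U (p - k)) (hU k hk) h
      exact ⟨q, fun _ => hq⟩
    · exact ⟨0, fun h => absurd h hk⟩
  choose q hq using hpair
  obtain ⟨s, hs⟩ : (p : ℤ_[p]) ∣ ∑ k ∈ Icc 1 (p - 1), U k ^ (m + 5) := by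
    rw [← Ideal.mem_span_singleton, ← PadicInt.maximalIdeal_eq_span_p, ← PadicInt.ker_toZMod,
      RingHom.mem_ker, map_sum, ← ZMod.sum_inv_pow_eq_zero p (m + 5) hdvd]
    refine sum_congr rfl fun k hk => ?_
    have h := congrArg PadicInt.toZMod (hU k hk)
    rw [map_mul, map_natCast, map_one] at h
    rw [map_pow, eq_inv_of_mul_eq_one_right h]
  set G : ℕ → ℤ_[p] := fun k =>
    12 * U k ^ m + 6 * m * p * U k ^ (m + 1) + m * (m + 1) * p ^ 2 * U k ^ (m + 2) with hG
  have hGrefl : ∑ k ∈ Icc 1 (p - 1), G (p - k) = ∑ k ∈ Icc 1 (p - 1), G k := by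
    refine sum_nbij' (fun k => p - k) (fun k => p - k) hrefl hrefl ?_ ?_ fun _ _ => rfl
    all_goals
      intro k hk
      rw [mem_Icc] at hk
      omega
  have hsum : 48 * ∑ k ∈ Icc 1 (p - 1), G k
      = p ^ 6 * (C * s + ∑ k ∈ Icc 1 (p - 1), q k) := by
    have h : 24 * (∑ k ∈ Icc 1 (p - 1), G k + ∑ k ∈ Icc 1 (p - 1), G (p - k))
        = C * p ^ 5 * ∑ k ∈ Icc 1 (p - 1), U k ^ (m + 5)
          + (∑ k ∈ Icc 1 (p - 1), q k) * p ^ 6 := by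
      rw [← sum_add_distrib, mul_sum, mul_sum, sum_mul, ← sum_add_distrib]
      exact sum_congr rfl hq
    rw [hGrefl, hs] at h
    linear_combination h
  obtain ⟨c, hc⟩ := h576.exists_right_inv
  have hUcast : ∀ n, ∑ k ∈ Icc 1 (p - 1), (1 : ℚ_[p]) / (k ^ n)
      = ((∑ k ∈ Icc 1 (p - 1), U k ^ n : ℤ_[p]) : ℚ_[p]) := by
    intro n
    rw [PadicInt.coe_sum]
    refine sum_congr rfl fun k hk => ?_
    have h : (k : ℚ_[p]) * U k = 1 := by
      exact_mod_cast congrArg (fun x : ℤ_[p] => (x : ℚ_[p])) (hU k hk)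
    rw [PadicInt.coe_pow, eq_inv_of_mul_eq_one_right h, inv_pow, one_div]
  have hGsum : ∑ k ∈ Icc 1 (p - 1), G k = 12 * ∑ k ∈ Icc 1 (p - 1), U k ^ m
      + 6 * m * p * ∑ k ∈ Icc 1 (p - 1), U k ^ (m + 1)
      + m * (m + 1) * p ^ 2 * ∑ k ∈ Icc 1 (p - 1), U k ^ (m + 2) := by
    simp only [hG, sum_add_distrib, mul_sum]
  rw [hGsum] at hsum
  unfold PModEq
  refine isPInteger_of_padicInt_eq (c * (C * s + ∑ k ∈ Icc 1 (p - 1), q k)) ?_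
  have hp0 : (p : ℚ_[p]) ≠ 0 := by exact_mod_cast hp.ne_zero
  push_cast
  rw [hUcast, hUcast, hUcast, sub_zero, div_eq_iff (pow_ne_zero 6 hp0)]
  have hsum' := congrArg (fun x : ℤ_[p] => (x : ℚ_[p])) hsum
  have hc' := congrArg (fun x : ℤ_[p] => (x : ℚ_[p])) hc
  have h576' : ((576 : ℤ_[p]) : ℚ_[p]) = 576 := rfl
  have h48' : ((48 : ℤ_[p]) : ℚ_[p]) = 48 := rfl
  have h12' : ((12 : ℤ_[p]) : ℚ_[p]) = 12 := rfl
  have h6' : ((6 : ℤ_[p]) : ℚ_[p]) = 6 := rfl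
  push_cast [h576', h48', h12', h6'] at hsum' hc' ⊢
  linear_combination c * hsum' - (((∑ k ∈ Icc 1 (p - 1), U k ^ m : ℤ_[p]) : ℚ_[p])
    + 1 / 2 * m * p * ((∑ k ∈ Icc 1 (p - 1), U k ^ (m + 1) : ℤ_[p]) : ℚ_[p])
    + m * (m + 1) / 12 * p ^ 2
      * ((∑ k ∈ Icc 1 (p - 1), U k ^ (m + 2) : ℤ_[p]) : ℚ_[p])) * hc'
end

section
/- Let p ≥ 5 be a prime. Then ∑_{k=1}^{p−1} 1/k ≡ −(1/3)·p²·B_{p−3} (mod p³). -/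
open Finset

lemma sum_range_two_mul_shift {M : Type*} [AddCommGroup M] (f : ℕ → M) (h : ℕ) :
    ∑ k ∈ range (2 * h), f (2 * (k + 1)) - ∑ k ∈ range (2 * h), f (k + 1) =
      ∑ i ∈ range h, (f (2 * i + 1 + (2 * h + 1)) - f (2 * i + 1)) := by
  have h1 : ∑ k ∈ range (2 * h), f (k + 1) =
      ∑ i ∈ range h, f (2 * i + 1) + ∑ i ∈ range h, f (2 * (i + 1)) := by
    rw [← sum_add_distrib]
    generalize h = n
    induction n with
    | zero => simp
    | succ n ih =>
      rw [sum_range_succ, ← ih, mul_add, mul_one, sum_range_succ, sum_range_succ, add_assoc]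
  rw [h1, two_mul h, sum_range_add, sum_sub_distrib, ← two_mul]
  rw [show ∑ x ∈ range h, f (2 * (h + x + 1)) = ∑ i ∈ range h, f (2 * i + 1 + (2 * h + 1)) from
    sum_congr rfl fun i _ => by congr 1; ring]
  abel

/-- The subring of `ℚ` consisting of the `p`-integral rationals. -/
noncomputable def pIntegers (p : ℕ) [Fact p.Prime] : Subring ℚ :=
  (PadicInt.subring p).comap (Rat.castHom ℚ_[p])

section

variable {p : ℕ} [hp : Fact p.Prime]

lemma mem_pIntegers {x : ℚ} : x ∈ pIntegers p ↔ ‖(x : ℚ_[p])‖ ≤ 1 := Iff.rfl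

lemma isPInteger_of_mem {x : ℚ} (hx : x ∈ pIntegers p) : IsPInteger p x := by
  rw [mem_pIntegers, Padic.norm_le_one_iff_val_nonneg, Padic.valuation_ratCast] at hx
  exact hx

lemma natCast_inv_mem {k : ℕ} (hk : ¬ p ∣ k) : (k : ℚ)⁻¹ ∈ pIntegers p := by
  have h : ‖(k : ℚ_[p])‖ = 1 :=
    (Padic.norm_natCast_eq_one_iff).2 ((Nat.Prime.coprime_iff_not_dvd hp.out).2 hk)
  simp [mem_pIntegers, h]

lemma natCast_inv_mem_of_lt {k : ℕ} (hk : 0 < k) (hkp : k < p) : (k : ℚ)⁻¹ ∈ pIntegers p :=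
  natCast_inv_mem (Nat.not_dvd_of_pos_of_lt hk hkp)

lemma bernoulli_mem {n : ℕ} (hn : n + 1 < p) : bernoulli n ∈ pIntegers p := by
  induction n using Nat.strong_induction_on with
  | _ n ih =>
    have h := sum_bernoulli (n + 1)
    rw [sum_range_succ, Nat.choose_succ_self_right] at h
    have hn0 : ((n + 1 : ℕ) : ℚ) ≠ 0 := by positivity
    have : bernoulli n = ((n + 1 : ℕ) : ℚ)⁻¹ * ((if n + 1 = 1 then 1 else 0) -
        ∑ k ∈ range n, ((n + 1).choose k : ℚ) * bernoulli k) := by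
      rw [← h]; field_simp; ring
    rw [this]
    refine mul_mem (natCast_inv_mem_of_lt (by omega) hn) (sub_mem ?_ (sum_mem fun k hk => ?_))
    · split_ifs
      exacts [one_mem _, zero_mem _]
    · rw [mem_range] at hk
      exact mul_mem (natCast_mem _ _) (ih k hk (by omega))

/-- `p * B_m` computes the `m`-th power sum modulo `p ^ 2`. -/
lemma sum_pow_modEq_bernoulli {m : ℕ} (hm : m + 1 < p) :
    ∃ c ∈ pIntegers p, ∑ k ∈ range p, (k : ℚ) ^ m = p * bernoulli m + p ^ 2 * c := by
  refine ⟨∑ i ∈ range m, bernoulli i * ((m + 1).choose i : ℚ) * (p : ℚ) ^ (m - 1 - i) *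
    ((m + 1 : ℕ) : ℚ)⁻¹, sum_mem fun i hi => ?_, ?_⟩
  · rw [mem_range] at hi
    exact mul_mem (mul_mem (mul_mem (bernoulli_mem (by omega)) (natCast_mem _ _))
      (pow_mem (natCast_mem _ _) _)) (natCast_inv_mem_of_lt (by omega) hm)
  · rw [sum_range_pow, sum_range_succ, add_comm, mul_sum]
    congr 1
    · have : (m : ℚ) + 1 ≠ 0 := by positivity
      rw [Nat.choose_succ_self_right, Nat.add_sub_cancel_left]
      push_cast
      field_simp
    · refine sum_congr rfl fun i hi => ?_
      rw [mem_range] at hi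
      rw [show m + 1 - i = 2 + (m - 1 - i) by omega, pow_add]
      push_cast
      ring

lemma sum_pow_succ_modEq_bernoulli {m : ℕ} (hm0 : m ≠ 0) (hm : m + 1 < p) :
    ∃ c ∈ pIntegers p,
      ∑ k ∈ range (p - 1), ((k + 1 : ℕ) : ℚ) ^ m = p * bernoulli m + p ^ 2 * c := by
  obtain ⟨c, hc, h⟩ := sum_pow_modEq_bernoulli hm
  refine ⟨c, hc, ?_⟩
  rw [← h, ← Nat.sub_add_cancel hp.out.one_le, sum_range_succ']
  simp [hm0]

lemma inv_pow_modEq {k m r : ℕ} (hk : ¬ p ∣ k) (hm : m + r = p - 1) :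
    ∃ c ∈ pIntegers p, (k : ℚ) ^ m = ((k : ℚ)⁻¹) ^ r + p * c := by
  have hk0 : (k : ℚ) ≠ 0 := by
    rintro h
    exact hk (by simp [Nat.cast_eq_zero.1 h])
  have h : (k : ℤ) ^ (p - 1) ≡ 1 [ZMOD p] := Int.ModEq.pow_card_sub_one_eq_one hp.out
    (Nat.isCoprime_iff_coprime.2 ((Nat.Prime.coprime_iff_not_dvd hp.out).2 hk).symm)
  obtain ⟨t, ht⟩ := h.symm.dvd
  have ht' : (k : ℚ) ^ (p - 1) - 1 = p * t := by exact_mod_cast ht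
  refine ⟨t * ((k : ℚ)⁻¹) ^ r, mul_mem (intCast_mem _ _) (pow_mem (natCast_inv_mem hk) _), ?_⟩
  rw [← hm, pow_add] at ht'
  rw [← mul_assoc, ← ht', sub_mul, mul_assoc, ← mul_pow, mul_inv_cancel₀ hk0]
  ring

lemma exists_sum_eq {ι : Type*} (s : Finset ι) (a : ℚ) (f g : ι → ℚ)
    (h : ∀ i ∈ s, ∃ c ∈ pIntegers p, f i = g i + a * c) :
    ∃ c ∈ pIntegers p, ∑ i ∈ s, f i = ∑ i ∈ s, g i + a * c := by
  choose! c hc hfg using h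
  exact ⟨∑ i ∈ s, c i, sum_mem hc, by rw [mul_sum, ← sum_add_distrib]; exact sum_congr rfl hfg⟩

/-- `3 ∑ 1 / k ^ 2 ≡ 2 ∑ k ^ (p - 3)` modulo `p ^ 2`. -/
lemma sum_inv_sq_modEq_sum_pow (hp5 : 5 ≤ p) : ∃ c ∈ pIntegers p,
    3 * ∑ k ∈ range (p - 1), (((k + 1 : ℕ) : ℚ)⁻¹) ^ 2 =
      2 * ∑ k ∈ range (p - 1), ((k + 1 : ℕ) : ℚ) ^ (p - 3) + p ^ 2 * c := by
  obtain ⟨h, hh⟩ : ∃ h, p = 2 * h + 1 := hp.out.odd_of_ne_two (by omega)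
  have hp1 : p - 1 = 2 * h := by omega
  have hnd : ∀ i < h, ¬ p ∣ 2 * i + 1 := fun i hi =>
    Nat.not_dvd_of_pos_of_lt (by omega) (by omega)
  have hnd' : ∀ i < h, ¬ p ∣ 2 * i + 1 + p := fun i hi => by
    simpa using hnd i hi
  have e1 := sum_range_two_mul_shift (fun k => ((k : ℚ)⁻¹) ^ 2) h
  have e2 := sum_range_two_mul_shift (fun k => (k : ℚ) ^ (p - 3)) h
  rw [← hh, ← hp1] at e1 e2
  set S := ∑ k ∈ range (p - 1), (((k + 1 : ℕ) : ℚ)⁻¹) ^ 2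
  set P := ∑ k ∈ range (p - 1), ((k + 1 : ℕ) : ℚ) ^ (p - 3)
  set T := ∑ i ∈ range h, (((2 * i + 1 : ℕ) : ℚ)⁻¹) ^ 3 with hT
  obtain ⟨a, ha, hSa⟩ := exists_sum_eq (p := p) (range h) ((p : ℚ) ^ 2)
    (fun i => (((2 * i + 1 + p : ℕ) : ℚ)⁻¹) ^ 2 - (((2 * i + 1 : ℕ) : ℚ)⁻¹) ^ 2)
    (fun i => -2 * p * (((2 * i + 1 : ℕ) : ℚ)⁻¹) ^ 3) fun i hi => by
      rw [mem_range] at hi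
      refine ⟨((3 * (2 * i + 1) + 2 * p : ℕ) : ℚ) * ((((2 * i + 1 : ℕ) : ℚ)⁻¹) ^ 3 *
        (((2 * i + 1 + p : ℕ) : ℚ)⁻¹) ^ 2), mul_mem (natCast_mem _ _) (mul_mem
          (pow_mem (natCast_inv_mem (hnd i hi)) _) (pow_mem (natCast_inv_mem (hnd' i hi)) _)), ?_⟩
      have h1 : ((2 * i + 1 : ℕ) : ℚ) ≠ 0 := by positivity
      have h2 : ((2 * i + 1 : ℕ) : ℚ) + p ≠ 0 := by positivity
      rw [Nat.cast_add (2 * i + 1) p, Nat.cast_add (3 * (2 * i + 1)), Nat.cast_mul 3]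
      generalize ((2 * i + 1 : ℕ) : ℚ) = s at *
      push_cast
      field_simp
      ring
  obtain ⟨b, hb, hPb⟩ := exists_sum_eq (p := p) (range h) ((p : ℚ) ^ 2)
    (fun i => (((2 * i + 1 + p : ℕ) : ℚ)) ^ (p - 3) - (((2 * i + 1 : ℕ) : ℚ)) ^ (p - 3))
    (fun i => -3 * p * (((2 * i + 1 : ℕ) : ℚ)⁻¹) ^ 3) fun i hi => by
      rw [mem_range] at hi
      obtain ⟨c, hc, hce⟩ := inv_pow_modEq (p := p) (k := 2 * i + 1) (m := p - 4) (r := 3)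
        (hnd i hi) (by omega)
      obtain ⟨d, hd⟩ := Polynomial.powAddExpansion (2 * i + 1) p (p - 3)
      have hi' := natCast_inv_mem (hnd i hi)
      generalize 2 * i + 1 = o at *
      have hd' : ((o : ℚ) + p) ^ (p - 3) = o ^ (p - 3) +
          ((p - 3 : ℕ) : ℚ) * o ^ (p - 3 - 1) * p + d * p ^ 2 := by exact_mod_cast hd
      rw [Nat.sub_sub, Nat.cast_sub (by omega), hce] at hd'
      refine ⟨(o : ℚ)⁻¹ ^ 3 + ((p : ℚ) - 3) * c + d, add_mem (add_mem (pow_mem hi' _)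
        (mul_mem (sub_mem (natCast_mem _ _) (ofNat_mem _ 3)) hc)) (natCast_mem _ _), ?_⟩
      rw [Nat.cast_add o p, hd']
      push_cast
      ring
  obtain ⟨c, hc, hce⟩ := inv_pow_modEq (p := p) (k := 2) (m := p - 3) (r := 2)
    (Nat.not_dvd_of_pos_of_lt (by omega) (by omega)) (by omega)
  have hS : ∑ k ∈ range (p - 1), (((2 * (k + 1) : ℕ) : ℚ)⁻¹) ^ 2 = 1 / 4 * S := by
    rw [mul_sum]
    refine sum_congr rfl fun k _ => ?_
    rw [Nat.cast_mul, mul_inv, mul_pow]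
    norm_num
  have hP : ∑ k ∈ range (p - 1), ((2 * (k + 1) : ℕ) : ℚ) ^ (p - 3) = (1 / 4 + p * c) * P := by
    rw [show (1 / 4 : ℚ) = (((2 : ℕ) : ℚ)⁻¹) ^ 2 by norm_num, ← hce, mul_sum]
    exact sum_congr rfl fun k _ => by rw [Nat.cast_mul, mul_pow]
  obtain ⟨v, hv, hPv⟩ : ∃ v ∈ pIntegers p, P = p * v := by
    obtain ⟨d, hd, hPd⟩ := sum_pow_succ_modEq_bernoulli (p := p) (m := p - 3) (by omega) (by omega)
    exact ⟨bernoulli (p - 3) + p * d, add_mem (bernoulli_mem (by omega))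
      (mul_mem (natCast_mem _ _) hd), by linear_combination hPd⟩
  rw [hS, hSa, ← mul_sum, ← hT] at e1
  rw [hP, hPb, ← mul_sum, ← hT] at e2
  refine ⟨-4 * ((3 : ℕ) : ℚ)⁻¹ * (3 * a - 2 * b + 2 * c * v), ?_, ?_⟩
  · have h3 := natCast_inv_mem_of_lt (p := p) (k := 3) (by omega) (by omega)
    have hn (n : ℕ) [n.AtLeastTwo] : (ofNat(n) : ℚ) ∈ pIntegers p := ofNat_mem _ n
    exact mul_mem (mul_mem (neg_mem (hn 4)) h3)
      (add_mem (sub_mem (mul_mem (hn 3) ha) (mul_mem (hn 2) hb)) (mul_mem (mul_mem (hn 2) hc) hv))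
  · push_cast
    linear_combination -4 * e1 + 8 / 3 * e2 - 8 / 3 * p * c * hPv

lemma sum_inv_cube_mem (hp2 : 2 < p) : ∃ c ∈ pIntegers p,
    ∑ k ∈ range (p - 1), (((k + 1 : ℕ) : ℚ)⁻¹) ^ 3 = p * c := by
  have hr := sum_range_reflect (fun k => (((k + 1 : ℕ) : ℚ)⁻¹) ^ 3) (p - 1)
  obtain ⟨c, hc, h⟩ := exists_sum_eq (p := p) (range (p - 1)) p
    (fun k => (((k + 1 : ℕ) : ℚ)⁻¹) ^ 3 + (((p - 1 - 1 - k + 1 : ℕ) : ℚ)⁻¹) ^ 3)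
    (fun _ => 0) fun k hk => by
      rw [mem_range] at hk
      obtain ⟨l, hl⟩ : ∃ l, p = k + 1 + (l + 1) := ⟨p - 1 - 1 - k, by omega⟩
      rw [show p - 1 - 1 - k = l by omega]
      have h1 := natCast_inv_mem_of_lt (p := p) (k := k + 1) (by omega) (by omega)
      have h2 := natCast_inv_mem_of_lt (p := p) (k := l + 1) (by omega) (by omega)
      have hlq : (p : ℚ) = ((k + 1 : ℕ) : ℚ) + ((l + 1 : ℕ) : ℚ) := by exact_mod_cast hl
      have hx : ((k + 1 : ℕ) : ℚ) ≠ 0 := by positivity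
      have hy : ((l + 1 : ℕ) : ℚ) ≠ 0 := by positivity
      have hxm := natCast_mem (pIntegers p) (k + 1)
      have hym := natCast_mem (pIntegers p) (l + 1)
      rw [hlq]
      generalize ((k + 1 : ℕ) : ℚ) = x at *
      generalize ((l + 1 : ℕ) : ℚ) = y at *
      refine ⟨(x ^ 2 - x * y + y ^ 2) * (x⁻¹ ^ 3 * y⁻¹ ^ 3), mul_mem (add_mem (sub_mem
        (pow_mem hxm _) (mul_mem hxm hym)) (pow_mem hym _))
        (mul_mem (pow_mem h1 _) (pow_mem h2 _)), ?_⟩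
      field_simp
      ring
  rw [sum_add_distrib, hr, sum_const_zero] at h
  refine ⟨((2 : ℕ) : ℚ)⁻¹ * c, mul_mem (natCast_inv_mem_of_lt (by omega) (by omega)) hc, ?_⟩
  rw [Nat.cast_ofNat]
  linear_combination h / 2

/-- `2 ∑ 1 / k ≡ -p ∑ 1 / k ^ 2` modulo `p ^ 3`. -/
lemma sum_inv_modEq_sum_inv_sq (hp2 : 2 < p) : ∃ c ∈ pIntegers p,
    2 * ∑ k ∈ range (p - 1), ((k + 1 : ℕ) : ℚ)⁻¹ =
      -p * ∑ k ∈ range (p - 1), (((k + 1 : ℕ) : ℚ)⁻¹) ^ 2 + p ^ 3 * c := by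
  have hr := sum_range_reflect (fun k => ((k + 1 : ℕ) : ℚ)⁻¹) (p - 1)
  obtain ⟨c, hc, h⟩ := exists_sum_eq (p := p) (range (p - 1)) ((p : ℚ) ^ 3)
    (fun k => ((k + 1 : ℕ) : ℚ)⁻¹ + ((p - 1 - 1 - k + 1 : ℕ) : ℚ)⁻¹)
    (fun k => -p * (((k + 1 : ℕ) : ℚ)⁻¹) ^ 2 + -p ^ 2 * (((k + 1 : ℕ) : ℚ)⁻¹) ^ 3)
    fun k hk => by
      rw [mem_range] at hk
      obtain ⟨l, hl⟩ : ∃ l, p = k + 1 + (l + 1) := ⟨p - 1 - 1 - k, by omega⟩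
      rw [show p - 1 - 1 - k = l by omega]
      have h1 := natCast_inv_mem_of_lt (p := p) (k := k + 1) (by omega) (by omega)
      have h2 := natCast_inv_mem_of_lt (p := p) (k := l + 1) (by omega) (by omega)
      have hlq : (p : ℚ) = ((k + 1 : ℕ) : ℚ) + ((l + 1 : ℕ) : ℚ) := by exact_mod_cast hl
      refine ⟨((k + 1 : ℕ) : ℚ)⁻¹ ^ 3 * ((l + 1 : ℕ) : ℚ)⁻¹, mul_mem (pow_mem h1 _) h2, ?_⟩
      have hx : ((k + 1 : ℕ) : ℚ) ≠ 0 := by positivity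
      have hy : ((l + 1 : ℕ) : ℚ) ≠ 0 := by positivity
      rw [hlq]
      generalize ((k + 1 : ℕ) : ℚ) = x at *
      generalize ((l + 1 : ℕ) : ℚ) = y at *
      field_simp
      ring
  obtain ⟨d, hd, hd3⟩ := sum_inv_cube_mem hp2
  rw [sum_add_distrib, hr, sum_add_distrib, ← mul_sum, ← mul_sum, hd3] at h
  exact ⟨c - d, sub_mem hc hd, by linear_combination h⟩

end

theorem harmonic_sum_bernoulli_mod_p3 (p : ℕ) (hp : p.Prime) (hp5 : 5 ≤ p) :
    PModEq p 3 (∑ k ∈ Finset.Icc 1 (p - 1), (1 : ℚ) / k)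
      (-(1 / 3) * p ^ 2 * bernoulli (p - 3)) := by
  have : Fact p.Prime := ⟨hp⟩
  obtain ⟨a, ha, hH⟩ := sum_inv_modEq_sum_inv_sq (p := p) (by omega)
  obtain ⟨b, hb, hS⟩ := sum_inv_sq_modEq_sum_pow hp5
  obtain ⟨c, hc, hP⟩ := sum_pow_succ_modEq_bernoulli (p := p) (m := p - 3) (by omega) (by omega)
  have hI : ∑ k ∈ Finset.Icc 1 (p - 1), (1 : ℚ) / k =
      ∑ k ∈ range (p - 1), ((k + 1 : ℕ) : ℚ)⁻¹ := by
    rw [range_eq_Ico, sum_Ico_add' (fun k : ℕ => (k : ℚ)⁻¹) 0 (p - 1) 1]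
    simp only [one_div]
    rfl
  have hn (n : ℕ) [n.AtLeastTwo] : (ofNat(n) : ℚ) ∈ pIntegers p := ofNat_mem _ n
  have hmem : ((2 : ℕ) : ℚ)⁻¹ * ((3 : ℕ) : ℚ)⁻¹ * (3 * a - b - 2 * c) ∈ pIntegers p :=
    mul_mem (mul_mem (natCast_inv_mem_of_lt (by omega) (by omega))
      (natCast_inv_mem_of_lt (by omega) (by omega)))
      (sub_mem (sub_mem (mul_mem (hn 3) ha) hb) (mul_mem (hn 2) hc))
  have hp0 : (p : ℚ) ≠ 0 := by exact_mod_cast hp.ne_zero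
  rw [PModEq, hI]
  convert isPInteger_of_mem hmem using 1
  rw [div_eq_iff (by positivity)]
  push_cast at *
  linear_combination hH / 2 - p / 6 * hS - p / 3 * hP
end
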